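/- arXiv:2204.08635 — 2 statements merged into one kernel-verified Lean document; each statement's English description precedes it below -/
import Mathlib

section
/- Let n ≥ 1, t ∈ (0,∞), r ∈ (1,∞) and q ∈ (1,∞). Then the Hardy–Littlewood maximal operator is bounded on the slice space (E_r^q)_t(ℝⁿ): there is a constant C > 0, independent of f, such that for every locally integrable f : ℝⁿ → ℂ, ‖Mf‖_{(E_r^q)_t} ≤ C ‖f‖_{(E_r^q)_t}. -/
open MeasureTheory Metric Set ENNReal
open scoped NNReal

noncomputable section

abbrev En (n : ℕ) : Type := EuclideanSpace ℝ (Fin n)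

/-- Slice norm `‖f‖_{(E_r^q)_t}` for `ℝ≥0∞`-valued functions. -/
def sliceNorm (n : ℕ) (t r : ℝ) (q : ℝ≥0∞) (g : En n → ℝ≥0∞) : ℝ≥0∞ :=
  if q = ∞ then
    essSup (fun x => ((volume (ball x t))⁻¹ * ∫⁻ y in ball x t, g y ^ r) ^ (1 / r)) volume
  else
    (∫⁻ x, (((volume (ball x t))⁻¹ * ∫⁻ y in ball x t, g y ^ r) ^ (1 / r)) ^ q.toReal) ^ (1 / q.toReal)

/-- Slice norm of a complex-valued function. -/
def sliceNormC (n : ℕ) (t r : ℝ) (q : ℝ≥0∞) (f : En n → ℂ) : ℝ≥0∞ :=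
  sliceNorm n t r q fun y => (‖f y‖₊ : ℝ≥0∞)

/-- The ball `B_k = {x : |x| ≤ 2^k}`. -/
def ballZ (n : ℕ) (k : ℤ) : Set (En n) := closedBall 0 ((2 : ℝ) ^ k)

/-- The shell `S_k = B_k \ B_{k-1}`. -/
def shell (n : ℕ) (k : ℤ) : Set (En n) := ballZ n k \ ballZ n (k - 1)

/-- Homogeneous Herz-slice norm of an `ℝ≥0∞`-valued function. -/
def herzHom (n : ℕ) (t r : ℝ) (q : ℝ≥0∞) (α : ℝ) (p : ℝ≥0∞) (g : En n → ℝ≥0∞) : ℝ≥0∞ :=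
  if p = ∞ then
    ⨆ k : ℤ, (2 : ℝ≥0∞) ^ ((k : ℝ) * α) * sliceNorm n t r q ((shell n k).indicator g)
  else
    (∑' k : ℤ, ((2 : ℝ≥0∞) ^ ((k : ℝ) * α) * sliceNorm n t r q ((shell n k).indicator g)) ^ p.toReal) ^ (1 / p.toReal)

/-- Homogeneous Herz-slice norm of a complex-valued function. -/
def herzHomC (n : ℕ) (t r : ℝ) (q : ℝ≥0∞) (α : ℝ) (p : ℝ≥0∞) (f : En n → ℂ) : ℝ≥0∞ :=
  herzHom n t r q α p fun y => (‖f y‖₊ : ℝ≥0∞)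

/-- The `k`-th piece in the non-homogeneous decomposition: `B_0` for `k = 0`, `S_k` for `k ≥ 1`. -/
def pieceN (n : ℕ) (k : ℕ) : Set (En n) := if k = 0 then ballZ n 0 else shell n k

/-- Non-homogeneous Herz-slice norm of an `ℝ≥0∞`-valued function. -/
def herzNonHom (n : ℕ) (t r : ℝ) (q : ℝ≥0∞) (α : ℝ) (p : ℝ≥0∞) (g : En n → ℝ≥0∞) : ℝ≥0∞ :=
  if p = ∞ then
    ⨆ k : ℕ, (2 : ℝ≥0∞) ^ ((k : ℝ) * α) * sliceNorm n t r q ((pieceN n k).indicator g)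
  else
    (∑' k : ℕ, ((2 : ℝ≥0∞) ^ ((k : ℝ) * α) * sliceNorm n t r q ((pieceN n k).indicator g)) ^ p.toReal) ^ (1 / p.toReal)

/-- Non-homogeneous Herz-slice norm of a complex-valued function. -/
def herzNonHomC (n : ℕ) (t r : ℝ) (q : ℝ≥0∞) (α : ℝ) (p : ℝ≥0∞) (f : En n → ℂ) : ℝ≥0∞ :=
  herzNonHom n t r q α p fun y => (‖f y‖₊ : ℝ≥0∞)

/-- Hardy–Littlewood maximal operator. -/
def maximal (n : ℕ) (f : En n → ℂ) (x : En n) : ℝ≥0∞ :=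
  ⨆ (ρ : ℝ) (_ : 0 < ρ), (volume (ball x ρ))⁻¹ * ∫⁻ y in ball x ρ, (‖f y‖₊ : ℝ≥0∞)


def MM {n : ℕ} (g : En n → ℝ≥0∞) (x : En n) : ℝ≥0∞ :=
  ⨆ (ρ : ℝ) (_ : 0 < ρ), (volume (ball x ρ))⁻¹ * ∫⁻ y in ball x ρ, g y

lemma vol_ball_ne_zero {n : ℕ} (x : En n) {ρ : ℝ} (h : 0 < ρ) : volume (ball x ρ) ≠ 0 :=
  (measure_ball_pos volume x h).ne'

lemma vol_ball_ne_top {n : ℕ} (x : En n) (ρ : ℝ) : volume (ball x ρ) ≠ ∞ :=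
  measure_ball_lt_top.ne

lemma vol_ball_center {n : ℕ} (x y : En n) (ρ : ℝ) : volume (ball x ρ) = volume (ball y ρ) := by
  rw [Measure.addHaar_ball_center, Measure.addHaar_ball_center volume y]

lemma vol_ball_mul {n : ℕ} (x y : En n) {c : ℝ} (hc : 0 < c) (ρ : ℝ) :
    volume (ball x (c * ρ)) = ENNReal.ofReal (c ^ n) * volume (ball y ρ) := by
  rw [Measure.addHaar_ball_mul_of_pos volume x hc, Measure.addHaar_ball_center volume y]
  simp

lemma vol_closedBall_mul {n : ℕ} (x : En n) {c : ℝ} (hc : 0 < c) {ρ : ℝ} (hρ : 0 < ρ) :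
    volume (closedBall x (c * ρ)) = ENNReal.ofReal (c ^ n) * volume (ball x ρ) := by
  rw [← vol_ball_mul x x hc ρ, Measure.addHaar_closedBall volume x (by positivity),
    Measure.addHaar_ball_of_pos volume x (by positivity)]

lemma lt_MM_iff {n : ℕ} (g : En n → ℝ≥0∞) (x : En n) (a : ℝ≥0∞) :
    a < MM g x ↔ ∃ ρ : ℝ, 0 < ρ ∧ a < (volume (ball x ρ))⁻¹ * ∫⁻ y in ball x ρ, g y := by
  simp [MM, lt_iSup_iff]

lemma le_MM {n : ℕ} (g : En n → ℝ≥0∞) (x : En n) {ρ : ℝ} (hρ : 0 < ρ) :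
    (volume (ball x ρ))⁻¹ * ∫⁻ y in ball x ρ, g y ≤ MM g x :=
  le_iSup₂_of_le ρ hρ le_rfl

lemma isOpen_lt_MM {n : ℕ} (g : En n → ℝ≥0∞) (a : ℝ≥0∞) : IsOpen {x | a < MM g x} := by
  rw [Metric.isOpen_iff]
  intro x hx
  obtain ⟨ρ, hρ, h⟩ := (lt_MM_iff g x a).1 hx
  have hU : ball x ρ = ⋃ k : ℕ, ball x (ρ - 1 / ((k : ℝ) + 1)) := by
    ext y
    simp only [mem_ball, mem_iUnion]
    constructor
    · intro hy
      obtain ⟨k, hk⟩ := exists_nat_one_div_lt (sub_pos.2 hy)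
      exact ⟨k, by linarith⟩
    · rintro ⟨k, hk⟩
      have : (0:ℝ) < 1 / ((k : ℝ) + 1) := by positivity
      linarith
  have hmono : Monotone fun k : ℕ => ball x (ρ - 1 / ((k : ℝ) + 1)) := by
    intro i j hij
    apply ball_subset_ball
    have : 1 / ((j : ℝ) + 1) ≤ 1 / ((i : ℝ) + 1) := by
      apply one_div_le_one_div_of_le (by positivity)
      have : (i:ℝ) ≤ j := by exact_mod_cast hij
      linarith
    linarith
  have hI : ∫⁻ y in ball x ρ, g y = ⨆ k : ℕ, ∫⁻ y in ball x (ρ - 1 / ((k : ℝ) + 1)), g y := by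
    conv_lhs => rw [hU]
    exact setLIntegral_iUnion_of_directed _ hmono.directed_le
  rw [hI, ENNReal.mul_iSup, lt_iSup_iff] at h
  obtain ⟨k, hk⟩ := h
  refine ⟨1 / ((k : ℝ) + 1), by positivity, fun z hz => ?_⟩
  refine (lt_MM_iff g z a).2 ⟨ρ, hρ, hk.trans_le ?_⟩
  rw [vol_ball_center z x]
  gcongr
  apply ball_subset_ball'
  rw [mem_ball, dist_comm] at hz
  linarith

lemma measurable_MM {n : ℕ} (g : En n → ℝ≥0∞) : Measurable (MM g) :=
  measurable_of_Ioi fun a => (isOpen_lt_MM g a).measurableSet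

/-- weak type (1,1), truncated radii -/
lemma weak_trunc {n : ℕ} (g : En n → ℝ≥0∞) (a : ℝ≥0∞) (R : ℝ) :
    a * volume {x | ∃ ρ : ℝ, 0 < ρ ∧ ρ ≤ R ∧ a < (volume (ball x ρ))⁻¹ * ∫⁻ y in ball x ρ, g y}
      ≤ ENNReal.ofReal (5 ^ n) * ∫⁻ y, g y := by
  set S := {x : En n | ∃ ρ : ℝ, 0 < ρ ∧ ρ ≤ R ∧
    a < (volume (ball x ρ))⁻¹ * ∫⁻ y in ball x ρ, g y} with hS
  have hex : ∀ x : En n, ∃ ρ : ℝ, x ∈ S → (0 < ρ ∧ ρ ≤ R ∧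
    a < (volume (ball x ρ))⁻¹ * ∫⁻ y in ball x ρ, g y) := by
    intro x
    by_cases hx : x ∈ S
    · obtain ⟨ρ, h⟩ := hx
      exact ⟨ρ, fun _ => h⟩
    · exact ⟨0, fun h => absurd h hx⟩
  choose ρ hρ using hex
  obtain ⟨u, huS, hdisj, hcov⟩ := Vitali.exists_disjoint_subfamily_covering_enlargement_closedBall
    S (fun x => x) ρ R (fun x hx => (hρ x hx).2.1) 5 (by norm_num)
  have hucount : u.Countable := hdisj.countable_of_nonempty_interior fun b hb => by
    have : ball b (ρ b) ⊆ interior (closedBall b (ρ b)) := ball_subset_interior_closedBall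
    exact ⟨b, this (mem_ball_self (hρ b (huS hb)).1)⟩
  have hsub : S ⊆ ⋃ b ∈ u, closedBall b (5 * ρ b) := by
    intro x hx
    obtain ⟨b, hb, h⟩ := hcov x hx
    exact mem_biUnion hb (h (mem_closedBall_self (hρ x hx).1.le))
  have hdisj' : u.PairwiseDisjoint fun b => ball b (ρ b) :=
    hdisj.mono fun b => ball_subset_closedBall
  calc a * volume S ≤ a * ∑' b : u, volume (closedBall (b : En n) (5 * ρ b)) := by
        gcongr
        exact (measure_mono hsub).trans (measure_biUnion_le _ hucount _)
    _ = ∑' b : u, a * volume (closedBall (b : En n) (5 * ρ b)) := ENNReal.tsum_mul_left.symm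
    _ ≤ ∑' b : u, ENNReal.ofReal (5 ^ n) * ∫⁻ y in ball (b : En n) (ρ b), g y := by
        apply ENNReal.tsum_le_tsum
        rintro ⟨b, hb⟩
        obtain ⟨h0, -, h1⟩ := hρ b (huS hb)
        simp only
        rw [vol_closedBall_mul b (by norm_num) h0, mul_left_comm]
        gcongr
        calc a * volume (ball b (ρ b))
            ≤ ((volume (ball b (ρ b)))⁻¹ * ∫⁻ y in ball b (ρ b), g y) * volume (ball b (ρ b)) := by
              gcongr
          _ = ∫⁻ y in ball b (ρ b), g y := by
              rw [mul_right_comm, ENNReal.inv_mul_cancel (vol_ball_ne_zero b h0)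
                (vol_ball_ne_top b _), one_mul]
    _ = ENNReal.ofReal (5 ^ n) * ∑' b : u, ∫⁻ y in ball (b : En n) (ρ b), g y :=
        ENNReal.tsum_mul_left
    _ = ENNReal.ofReal (5 ^ n) * ∫⁻ y in ⋃ b ∈ u, ball b (ρ b), g y := by
        rw [lintegral_biUnion hucount (fun b _ => measurableSet_ball) hdisj']
    _ ≤ _ := by
        gcongr
        exact Measure.restrict_le_self

lemma weak_type {n : ℕ} (g : En n → ℝ≥0∞) (a : ℝ≥0∞) :
    a * volume {x | a < MM g x} ≤ ENNReal.ofReal (5 ^ n) * ∫⁻ y, g y := by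
  have : {x | a < MM g x} = ⋃ k : ℕ, {x | ∃ ρ : ℝ, 0 < ρ ∧ ρ ≤ k ∧
      a < (volume (ball x ρ))⁻¹ * ∫⁻ y in ball x ρ, g y} := by
    ext x
    simp only [mem_ofPred_eq, lt_MM_iff, mem_iUnion]
    constructor
    · rintro ⟨ρ, h, h'⟩
      obtain ⟨k, hk⟩ := exists_nat_ge ρ
      exact ⟨k, ρ, h, hk, h'⟩
    · rintro ⟨k, ρ, h, -, h'⟩
      exact ⟨ρ, h, h'⟩
  rw [this, Monotone.measure_iUnion, ENNReal.mul_iSup]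
  · exact iSup_le fun k => weak_trunc g a k
  · rintro i j hij x ⟨ρ, h, h1, h2⟩
    exact ⟨ρ, h, h1.trans (by exact_mod_cast hij), h2⟩

lemma MM_le_add {n : ℕ} {g : En n → ℝ≥0∞} (hg : Measurable g) (a : ℝ≥0∞) (x : En n) :
    MM g x ≤ MM ({y | a < g y}.indicator g) x + a := by
  refine iSup₂_le fun ρ hρ => ?_
  have hm : Measurable ({y | a < g y}.indicator g) := hg.indicator (measurableSet_lt measurable_const hg)
  calc (volume (ball x ρ))⁻¹ * ∫⁻ y in ball x ρ, g y
      ≤ (volume (ball x ρ))⁻¹ * ∫⁻ y in ball x ρ, ({y | a < g y}.indicator g y + a) := by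
        gcongr with y
        by_cases h : a < g y
        · simp [indicator, h]
        · simp [indicator, h]; exact not_lt.1 h
    _ = (volume (ball x ρ))⁻¹ * (∫⁻ y in ball x ρ, {y | a < g y}.indicator g y) + a := by
        rw [lintegral_add_left hm, mul_add]
        congr 1
        simp only [lintegral_const, Measure.restrict_apply_univ]
        rw [mul_comm a, ← mul_assoc, ENNReal.inv_mul_cancel (vol_ball_ne_zero x hρ)
          (vol_ball_ne_top x _), one_mul]
    _ ≤ _ := by
        gcongr
        exact le_MM _ x hρ

lemma layer_fin (b : ℝ) (hb : 0 ≤ b) {p : ℝ} (hp : 0 < p) :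
    ∫⁻ s in Ioo 0 b, ENNReal.ofReal (s ^ (p - 1)) = ENNReal.ofReal (b ^ p / p) := by
  rw [← ofReal_integral_eq_lintegral_ofReal]
  · rw [← integral_Ioc_eq_integral_Ioo, ← intervalIntegral.integral_of_le hb,
      integral_rpow (Or.inl (by linarith))]
    simp [Real.zero_rpow hp.ne']
  · have := (intervalIntegral.intervalIntegrable_rpow' (a := 0) (b := b) (r := p - 1)
      (by linarith)).1
    exact this.mono_set Ioo_subset_Ioc_self
  · filter_upwards [ae_restrict_mem measurableSet_Ioo] with s hs
    exact Real.rpow_nonneg hs.1.le _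

lemma layer (a : ℝ≥0∞) {p : ℝ} (hp : 0 < p) :
    ENNReal.ofReal p * ∫⁻ s in Ioi (0:ℝ), {s : ℝ | ENNReal.ofReal s < a}.indicator
      (fun s => ENNReal.ofReal (s ^ (p - 1))) s = a ^ p := by
  have hm : MeasurableSet {s : ℝ | ENNReal.ofReal s < a} :=
    measurableSet_lt ENNReal.measurable_ofReal measurable_const
  rw [setLIntegral_indicator hm]
  have key : ∀ b : ℝ, 0 ≤ b → ENNReal.ofReal p * ENNReal.ofReal (b ^ p / p) =
      ENNReal.ofReal b ^ p := by
    intro b hb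
    rw [← ENNReal.ofReal_mul hp.le, mul_div_cancel₀ _ hp.ne', ENNReal.ofReal_rpow_of_nonneg hb hp.le]
  by_cases ha : a = ∞
  · subst ha
    rw [ENNReal.top_rpow_of_pos hp]
    refine ENNReal.eq_top_of_forall_nnreal_le fun c => ?_
    have hc := key ((c : ℝ) ^ (1 / p)) (by positivity)
    rw [← layer_fin _ (by positivity) hp, ← ENNReal.ofReal_rpow_of_nonneg (by positivity)
      (by positivity), ← ENNReal.rpow_mul, one_div_mul_cancel hp.ne', ENNReal.rpow_one,
      ENNReal.ofReal_coe_nnreal] at hc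
    rw [← hc]
    gcongr
    intro s hs
    exact ⟨by simp, hs.1⟩
  · obtain ⟨b, hb, rfl⟩ : ∃ b : ℝ, 0 ≤ b ∧ a = ENNReal.ofReal b :=
      ⟨a.toReal, by simp, by simp [ha]⟩
    rw [← key b hb, ← layer_fin b hb hp]
    congr 3
    ext s
    simp only [mem_inter_iff, mem_ofPred_eq, mem_Ioi, mem_Ioo]
    constructor
    · rintro ⟨h1, h2⟩
      exact ⟨h2, (ENNReal.ofReal_lt_ofReal_iff_of_nonneg h2.le).1 h1⟩
    · rintro ⟨h1, h2⟩
      exact ⟨(ENNReal.ofReal_lt_ofReal_iff_of_nonneg h1.le).2 h2, h1⟩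

lemma layer2 {n : ℕ} {F G : En n → ℝ≥0∞} (hF : Measurable F) (hG : Measurable G) {p : ℝ}
    (hp : 0 < p) :
    ∫⁻ x, G x * F x ^ p = ENNReal.ofReal p * ∫⁻ s in Ioi (0:ℝ), ENNReal.ofReal (s ^ (p - 1)) *
      ∫⁻ x, {x | ENNReal.ofReal s < F x}.indicator G x := by
  have hφ : Measurable fun s : ℝ => ENNReal.ofReal (s ^ (p - 1)) := by fun_prop
  have hset : MeasurableSet {z : En n × ℝ | ENNReal.ofReal z.2 < F z.1} :=
    measurableSet_lt (ENNReal.measurable_ofReal.comp measurable_snd) (hF.comp measurable_fst)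
  have hjoint : Measurable ({z : En n × ℝ | ENNReal.ofReal z.2 < F z.1}.indicator
      fun z => G z.1 * ENNReal.ofReal (z.2 ^ (p - 1))) :=
    ((hG.comp measurable_fst).mul (hφ.comp measurable_snd)).indicator hset
  have h1 : ∀ x, G x * F x ^ p = ENNReal.ofReal p * ∫⁻ s in Ioi (0:ℝ),
      {z : En n × ℝ | ENNReal.ofReal z.2 < F z.1}.indicator
      (fun z => G z.1 * ENNReal.ofReal (z.2 ^ (p - 1))) (x, s) := by
    intro x
    rw [← layer (F x) hp, mul_left_comm, ← lintegral_const_mul]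
    · congr 2
      ext s
      by_cases h : ENNReal.ofReal s < F x <;> simp [indicator, h]
    · exact hφ.indicator (measurableSet_lt ENNReal.measurable_ofReal measurable_const)
  simp_rw [h1]
  rw [lintegral_const_mul _ (hjoint.lintegral_prod_right')]
  congr 1
  rw [lintegral_lintegral_swap (f := fun x s => {z : En n × ℝ | ENNReal.ofReal z.2 < F z.1}.indicator
      (fun z => G z.1 * ENNReal.ofReal (z.2 ^ (p - 1))) (x, s)) hjoint.aemeasurable]
  congr 1
  ext s
  rw [← lintegral_const_mul _ (hG.indicator (measurableSet_lt measurable_const hF))]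
  congr 1
  ext x
  by_cases h : ENNReal.ofReal s < F x <;> simp [indicator, h, mul_comm]

lemma strong_type (n : ℕ) {p : ℝ} (hp : 1 < p) : ∃ K : ℝ≥0∞, K ≠ ∞ ∧
    ∀ g : En n → ℝ≥0∞, Measurable g → ∫⁻ x, MM g x ^ p ≤ K * ∫⁻ x, g x ^ p := by
  have hp0 : 0 < p := by linarith
  have hp1 : 0 < p - 1 := by linarith
  have hne : ENNReal.ofReal (p - 1) ≠ 0 := by simpa using hp1
  refine ⟨2 ^ p * (ENNReal.ofReal p * (ENNReal.ofReal (5 ^ n) * (ENNReal.ofReal (p - 1))⁻¹)), ?_, ?_⟩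
  · have : (ENNReal.ofReal (p - 1))⁻¹ ≠ ∞ := ENNReal.inv_ne_top.2 hne
    have h2 : (2:ℝ≥0∞) ^ p ≠ ∞ := ENNReal.rpow_ne_top_of_nonneg hp0.le (by simp)
    finiteness
  intro g hg
  have hM := measurable_MM g
  have hF : Measurable fun x => MM g x / 2 := hM.div_const 2
  have e1 : ∫⁻ x, MM g x ^ p = 2 ^ p * ∫⁻ x, 1 * (MM g x / 2) ^ p := by
    rw [← lintegral_const_mul _ (by fun_prop)]
    congr 1
    ext x
    rw [one_mul, ← ENNReal.mul_rpow_of_nonneg _ _ hp0.le, ENNReal.mul_div_cancel (by simp) (by simp)]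
  have e2 := layer2 (G := fun _ => 1) hF measurable_const hp0
  have e3 := layer2 hg hg hp1
  have e4 : ∀ x, g x * g x ^ (p - 1) = g x ^ p := by
    intro x
    conv_lhs => rw [← ENNReal.rpow_one (g x), ← ENNReal.rpow_mul, one_mul]
    rw [← ENNReal.rpow_add_of_nonneg _ _ zero_le_one hp1.le]
    congr 1; ring
  simp_rw [e4] at e3
  have e5 : ∫⁻ s in Ioi (0:ℝ), ENNReal.ofReal (s ^ (p - 1)) *
      ∫⁻ x, {x | ENNReal.ofReal s < MM g x / 2}.indicator (fun _ => 1) x ≤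
      ENNReal.ofReal (5 ^ n) * ∫⁻ s in Ioi (0:ℝ), ENNReal.ofReal (s ^ (p - 1 - 1)) *
      ∫⁻ x, {x | ENNReal.ofReal s < g x}.indicator g x := by
    rw [← lintegral_const_mul' _ _ (by finiteness)]
    refine setLIntegral_mono' measurableSet_Ioi fun s hs => ?_
    have hs : 0 < s := hs
    rw [show s ^ (p - 1) = s ^ (p - 1 - 1) * s by
      rw [← Real.rpow_add_one hs.ne']; congr 1; ring, ENNReal.ofReal_mul (by positivity), mul_assoc,
      mul_left_comm (ENNReal.ofReal (5 ^ n))]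
    refine mul_le_mul_right ?_ _
    have ei : ∫⁻ x, {x | ENNReal.ofReal s < MM g x / 2}.indicator (fun _ => (1 : ℝ≥0∞)) x =
        volume {x | ENNReal.ofReal s < MM g x / 2} :=
      lintegral_indicator_one (measurableSet_lt measurable_const hF)
    rw [ei]
    refine le_trans ?_ (weak_type _ (ENNReal.ofReal s))
    refine mul_le_mul_right (measure_mono fun x h => ?_) _
    have h : ENNReal.ofReal s < MM g x / 2 := h
    have h2 := MM_le_add hg (ENNReal.ofReal s) x
    rw [ENNReal.lt_div_iff_mul_lt (by simp) (by simp), mul_two] at h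
    exact lt_of_add_lt_add_right (h.trans_le h2)
  rw [e1, e2, mul_assoc, mul_assoc, mul_assoc, e3, ← mul_assoc (ENNReal.ofReal (p - 1))⁻¹,
    ENNReal.inv_mul_cancel hne (by finiteness), one_mul]
  gcongr

def AA {n : ℕ} (t r : ℝ) (g : En n → ℝ≥0∞) (x : En n) : ℝ≥0∞ :=
  ((volume (ball x t))⁻¹ * ∫⁻ y in ball x t, g y ^ r) ^ (1 / r)

lemma measurable_ballint {n : ℕ} (t : ℝ) {g : En n → ℝ≥0∞} (hg : Measurable g) :
    Measurable fun x => ∫⁻ y in ball x t, g y := by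
  simp_rw [← lintegral_indicator measurableSet_ball]
  have : Measurable ({z : En n × En n | dist z.2 z.1 < t}.indicator fun z => g z.2) :=
    (hg.comp measurable_snd).indicator (measurableSet_lt (by fun_prop) measurable_const)
  exact this.lintegral_prod_right'

lemma measurable_AA {n : ℕ} (t r : ℝ) {g : En n → ℝ≥0∞} (hg : Measurable g) :
    Measurable (AA t r g) := by
  unfold AA
  have := measurable_ballint t (hg.pow_const r)
  simp_rw [fun x : En n => vol_ball_center x 0 t]
  fun_prop

lemma avg_le_AA {n : ℕ} {t r : ℝ} (ht : 0 < t) (hr : 1 < r) {g : En n → ℝ≥0∞}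
    (hg : Measurable g) (x : En n) :
    (volume (ball x t))⁻¹ * ∫⁻ y in ball x t, g y ≤ AA t r g x := by
  have hc := Real.HolderConjugate.conjExponent hr
  have := ENNReal.lintegral_mul_le_Lp_mul_Lq ((volume (ball x t))⁻¹ • volume.restrict (ball x t))
    hc (f := g) (g := fun _ => 1) hg.aemeasurable aemeasurable_const
  simpa [AA, lintegral_smul_measure, ENNReal.inv_mul_cancel (vol_ball_ne_zero x ht)
    (vol_ball_ne_top x t)] using this

lemma fub {n : ℕ} {t : ℝ} {g : En n → ℝ≥0∞} (hg : Measurable g) (U W : Set (En n))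
    (hU : MeasurableSet U) (h : ∀ w ∈ U, ball w t ⊆ W) :
    volume (ball (0 : En n) t) * ∫⁻ w in U, g w ≤ ∫⁻ z in W, ∫⁻ w in ball z t, g w := by
  have hj : Measurable ({z : En n × En n | dist z.2 z.1 < t}.indicator fun z => g z.2) :=
    (hg.comp measurable_snd).indicator (measurableSet_lt (by fun_prop) measurable_const)
  have e : ∀ z, ∫⁻ w in ball z t, g w =
      ∫⁻ w, {z : En n × En n | dist z.2 z.1 < t}.indicator (fun z => g z.2) (z, w) := by
    intro z
    rw [← lintegral_indicator measurableSet_ball]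
    rfl
  simp_rw [e]
  rw [lintegral_lintegral_swap (f := fun z w => {z : En n × En n | dist z.2 z.1 < t}.indicator
    (fun z => g z.2) (z, w)) hj.aemeasurable, ← lintegral_const_mul _ hg]
  refine le_trans ?_ (setLIntegral_le_lintegral U _)
  refine setLIntegral_mono' hU fun w hw => ?_
  have e2 : ∀ z, {z : En n × En n | dist z.2 z.1 < t}.indicator (fun z => g z.2) (z, w) =
      (ball w t).indicator (fun _ => g w) z := by
    intro z
    simp [indicator, dist_comm]
  simp_rw [e2]
  rw [lintegral_indicator measurableSet_ball, Measure.restrict_restrict measurableSet_ball,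
    inter_eq_left.2 (h w hw), setLIntegral_const, vol_ball_center 0 w, mul_comm]

lemma large_part {n : ℕ} {t r : ℝ} (ht : 0 < t) (hr : 1 < r) {g : En n → ℝ≥0∞}
    (hg : Measurable g) {x y : En n} (hy : y ∈ ball x t) {ρ : ℝ} (hρ : t ≤ ρ) :
    (volume (ball y ρ))⁻¹ * ∫⁻ w in ball y ρ, g w ≤ ENNReal.ofReal (3 ^ n) * MM (AA t r g) x := by
  have hρ0 : 0 < ρ := by linarith
  have hy' : dist y x < t := hy
  have h1 := fub (t := t) hg (ball y ρ) (ball x (3 * ρ)) measurableSet_ball (fun w hw => by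
    have hw' : dist w y < ρ := hw
    apply ball_subset_ball'
    have := dist_triangle w y x
    linarith)
  have hV0 := vol_ball_ne_zero (0 : En n) ht
  have hVt := vol_ball_ne_top (0 : En n) t
  have h2 : ∫⁻ w in ball y ρ, g w ≤ ∫⁻ z in ball x (3 * ρ), AA t r g z := by
    calc ∫⁻ w in ball y ρ, g w = (volume (ball (0 : En n) t))⁻¹ *
          (volume (ball (0 : En n) t) * ∫⁻ w in ball y ρ, g w) := by
          rw [← mul_assoc, ENNReal.inv_mul_cancel hV0 hVt, one_mul]
      _ ≤ (volume (ball (0 : En n) t))⁻¹ * ∫⁻ z in ball x (3 * ρ), ∫⁻ w in ball z t, g w := by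
          gcongr
      _ = ∫⁻ z in ball x (3 * ρ), (volume (ball (0 : En n) t))⁻¹ * ∫⁻ w in ball z t, g w := by
          rw [lintegral_const_mul _ (measurable_ballint t hg)]
      _ ≤ _ := by
          gcongr with z
          rw [vol_ball_center 0 z]
          exact avg_le_AA ht hr hg z
  have h3 := le_MM (AA t r g) x (ρ := 3 * ρ) (by linarith)
  have hv := vol_ball_mul x y (c := 3) (by norm_num) ρ
  have h30 : ENNReal.ofReal (3 ^ n) ≠ 0 := by simp
  calc (volume (ball y ρ))⁻¹ * ∫⁻ w in ball y ρ, g w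
      ≤ (volume (ball y ρ))⁻¹ * ∫⁻ z in ball x (3 * ρ), AA t r g z := by gcongr
    _ = ENNReal.ofReal (3 ^ n) *
        ((volume (ball x (3 * ρ)))⁻¹ * ∫⁻ z in ball x (3 * ρ), AA t r g z) := by
        rw [hv, ENNReal.mul_inv (Or.inl h30) (Or.inl (by finiteness)), ← mul_assoc, ← mul_assoc,
          ENNReal.mul_inv_cancel h30 (by finiteness), one_mul]
    _ ≤ _ := by gcongr

lemma small_ball {n : ℕ} {t r : ℝ} (ht : 0 < t) (hr : 1 < r) {g : En n → ℝ≥0∞}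
    {x c : En n} (hc : dist c x ≤ 2 * t) :
    (volume (ball x t))⁻¹ * ∫⁻ w in ball c (t / 2), g w ^ r ≤
      (ENNReal.ofReal (6 ^ n) * MM (AA t r g) x) ^ r := by
  have hr0 : 0 < r := by linarith
  set m := (volume (ball x t))⁻¹ * ∫⁻ w in ball c (t / 2), g w ^ r with hm
  have h1 : ∀ z ∈ ball c (t / 2), m ^ (1 / r) ≤ AA t r g z := by
    intro z hz
    have hz' : dist z c < t / 2 := hz
    unfold AA
    rw [hm, vol_ball_center x z]
    gcongr
    apply ball_subset_ball'
    rw [dist_comm c z]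
    linarith
  have hV0 := vol_ball_ne_zero c (half_pos ht)
  have hVt := vol_ball_ne_top c (t / 2)
  have h2 : m ^ (1 / r) * volume (ball c (t / 2)) ≤ ∫⁻ z in ball x (3 * t), AA t r g z := by
    rw [← setLIntegral_const]
    refine (setLIntegral_mono' measurableSet_ball h1).trans ?_
    gcongr
    apply ball_subset_ball'
    linarith
  have h3 := le_MM (AA t r g) x (ρ := 3 * t) (by linarith)
  have hv := vol_ball_mul x c (c := 6) (by norm_num) (t / 2)
  rw [show 6 * (t / 2) = 3 * t by ring] at hv
  have h60 : ENNReal.ofReal (6 ^ n) ≠ 0 := by simp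
  have h4 : m ^ (1 / r) ≤ ENNReal.ofReal (6 ^ n) * MM (AA t r g) x := by
    calc m ^ (1 / r) = (volume (ball c (t / 2)))⁻¹ * (m ^ (1 / r) * volume (ball c (t / 2))) := by
          rw [mul_left_comm, ENNReal.inv_mul_cancel hV0 hVt, mul_one]
      _ ≤ (volume (ball c (t / 2)))⁻¹ * ∫⁻ z in ball x (3 * t), AA t r g z := by gcongr
      _ = ENNReal.ofReal (6 ^ n) *
        ((volume (ball x (3 * t)))⁻¹ * ∫⁻ z in ball x (3 * t), AA t r g z) := by
        rw [hv, ENNReal.mul_inv (Or.inl h60) (Or.inl (by finiteness)), ← mul_assoc, ← mul_assoc,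
          ENNReal.mul_inv_cancel h60 (by finiteness), one_mul]
      _ ≤ _ := by gcongr
  calc m = (m ^ (1 / r)) ^ r := by
        rw [← ENNReal.rpow_mul, one_div_mul_cancel hr0.ne', ENNReal.rpow_one]
    _ ≤ _ := by gcongr

lemma double_ball (n : ℕ) {t r : ℝ} (ht : 0 < t) (hr : 1 < r) : ∃ N : ℕ,
    ∀ (g : En n → ℝ≥0∞) (x : En n),
    (volume (ball x t))⁻¹ * ∫⁻ w in ball x (2 * t), g w ^ r ≤
      N * (ENNReal.ofReal (6 ^ n) * MM (AA t r g) x) ^ r := by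
  obtain ⟨T, hT, hfin, hcov⟩ := finite_cover_balls_of_compact
    (isCompact_closedBall (0 : En n) (2 * t)) (half_pos ht)
  have := hfin.fintype
  refine ⟨Fintype.card T, fun g x => ?_⟩
  have hsub : ball x (2 * t) ⊆ ⋃ v : T, ball (x + v) (t / 2) := by
    intro w hw
    have : w - x ∈ closedBall (0 : En n) (2 * t) := by
      rw [mem_closedBall, dist_zero_right, ← dist_eq_norm]
      exact (mem_ball.1 hw).le
    obtain ⟨v, hv, hv'⟩ := mem_iUnion₂.1 (hcov this)
    refine mem_iUnion.2 ⟨⟨v, hv⟩, ?_⟩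
    rw [mem_ball, dist_eq_norm] at hv' ⊢
    rwa [← sub_sub]
  calc (volume (ball x t))⁻¹ * ∫⁻ w in ball x (2 * t), g w ^ r
      ≤ (volume (ball x t))⁻¹ * ∑' v : T, ∫⁻ w in ball (x + v) (t / 2), g w ^ r := by
        gcongr
        exact (lintegral_mono_set hsub).trans (lintegral_iUnion_le _ _)
    _ = ∑ v : T, (volume (ball x t))⁻¹ * ∫⁻ w in ball (x + v) (t / 2), g w ^ r := by
        rw [tsum_fintype, Finset.mul_sum]
    _ ≤ ∑ v : T, (ENNReal.ofReal (6 ^ n) * MM (AA t r g) x) ^ r := by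
        refine Finset.sum_le_sum fun v _ => small_ball ht hr ?_
        have := hT v.2
        rw [mem_closedBall, dist_zero_right] at this
        simpa [dist_eq_norm] using this
    _ = _ := by simp

lemma pointwise {n : ℕ} {t r : ℝ} (ht : 0 < t) (hr : 1 < r) {g : En n → ℝ≥0∞}
    (hg : Measurable g) {x y : En n} (hy : y ∈ ball x t) :
    MM g y ≤ max (MM ((ball x (2 * t)).indicator g) y)
      (ENNReal.ofReal (3 ^ n) * MM (AA t r g) x) := by
  refine iSup₂_le fun ρ hρ => ?_
  rcases lt_or_ge ρ t with h | h
  · refine le_max_of_le_left ?_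
    refine le_trans (le_of_eq ?_) (le_MM _ y hρ)
    congr 1
    refine setLIntegral_congr_fun measurableSet_ball fun w hw => ?_
    rw [indicator_of_mem]
    have hw' : dist w y < ρ := hw
    have hy' : dist y x < t := hy
    have := dist_triangle w y x
    rw [mem_ball]
    linarith
  · exact le_max_of_le_right (large_part ht hr hg hy h)

lemma AA_MM (n : ℕ) {t r : ℝ} (ht : 0 < t) (hr : 1 < r) : ∃ K : ℝ≥0∞, K ≠ ∞ ∧
    ∀ g : En n → ℝ≥0∞, Measurable g → ∀ x, AA t r (MM g) x ≤ K * MM (AA t r g) x := by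
  have hr0 : 0 < r := by linarith
  obtain ⟨K, hK, hstrong⟩ := strong_type n hr
  obtain ⟨N, hN⟩ := double_ball n ht hr
  refine ⟨(K * (N * ENNReal.ofReal (6 ^ n) ^ r) + ENNReal.ofReal (3 ^ n) ^ r) ^ (1 / r), ?_, ?_⟩
  · have h1 : ENNReal.ofReal (6 ^ n) ^ r ≠ ∞ := ENNReal.rpow_ne_top_of_nonneg hr0.le (by simp)
    have h2 : ENNReal.ofReal (3 ^ n) ^ r ≠ ∞ := ENNReal.rpow_ne_top_of_nonneg hr0.le (by simp)
    exact ENNReal.rpow_ne_top_of_nonneg (by positivity) (by finiteness)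
  intro g hg x
  have hV0 := vol_ball_ne_zero x ht
  have hVt := vol_ball_ne_top x t
  set M := MM (AA t r g) x with hMdef
  set G := (ball x (2 * t)).indicator g with hG
  have hGm : Measurable G := hg.indicator measurableSet_ball
  have h1 : ∫⁻ y in ball x t, MM g y ^ r ≤
      K * (∫⁻ y in ball x (2 * t), g y ^ r) +
        (ENNReal.ofReal (3 ^ n) * M) ^ r * volume (ball x t) := by
    calc ∫⁻ y in ball x t, MM g y ^ r
        ≤ ∫⁻ y in ball x t, (MM G y ^ r + (ENNReal.ofReal (3 ^ n) * M) ^ r) := by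
          refine setLIntegral_mono' measurableSet_ball fun y hy => ?_
          have h := pointwise ht hr hg hy
          rcases le_max_iff.1 h with h | h
          · exact le_add_right (ENNReal.rpow_le_rpow h hr0.le)
          · exact le_add_left (ENNReal.rpow_le_rpow h hr0.le)
      _ = (∫⁻ y in ball x t, MM G y ^ r) + (ENNReal.ofReal (3 ^ n) * M) ^ r * volume (ball x t) := by
          rw [lintegral_add_right _ measurable_const, setLIntegral_const]
      _ ≤ _ := by
          gcongr
          refine (setLIntegral_le_lintegral _ _).trans ((hstrong G hGm).trans (le_of_eq ?_))
          congr 1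
          rw [← lintegral_indicator measurableSet_ball]
          congr 1
          ext y
          by_cases hy : y ∈ ball x (2 * t)
          · rw [hG, indicator_of_mem hy, indicator_of_mem hy]
          · rw [hG, indicator_of_notMem hy, indicator_of_notMem hy, ENNReal.zero_rpow_of_pos hr0]
  have h2 : (volume (ball x t))⁻¹ * ∫⁻ y in ball x t, MM g y ^ r ≤
      (K * (N * ENNReal.ofReal (6 ^ n) ^ r) + ENNReal.ofReal (3 ^ n) ^ r) * M ^ r := by
    calc (volume (ball x t))⁻¹ * ∫⁻ y in ball x t, MM g y ^ r
        ≤ (volume (ball x t))⁻¹ * (K * (∫⁻ y in ball x (2 * t), g y ^ r) +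
          (ENNReal.ofReal (3 ^ n) * M) ^ r * volume (ball x t)) := by gcongr
      _ = K * ((volume (ball x t))⁻¹ * ∫⁻ y in ball x (2 * t), g y ^ r) +
          (ENNReal.ofReal (3 ^ n) * M) ^ r := by
          rw [mul_add, mul_left_comm, mul_left_comm _ _ (volume (ball x t)),
            ENNReal.inv_mul_cancel hV0 hVt, mul_one]
      _ ≤ K * (N * (ENNReal.ofReal (6 ^ n) * M) ^ r) + (ENNReal.ofReal (3 ^ n) * M) ^ r := by
          exact add_le_add_left (mul_le_mul_right (hN g x) _) _
      _ = _ := by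
          rw [ENNReal.mul_rpow_of_nonneg _ _ hr0.le, ENNReal.mul_rpow_of_nonneg _ _ hr0.le]
          ring
  calc AA t r (MM g) x
      ≤ ((K * (N * ENNReal.ofReal (6 ^ n) ^ r) + ENNReal.ofReal (3 ^ n) ^ r) * M ^ r) ^ (1 / r) := by
        unfold AA
        gcongr
    _ = _ := by
        rw [ENNReal.mul_rpow_of_nonneg _ _ (by positivity), ← ENNReal.rpow_mul M,
          mul_one_div_cancel hr0.ne', ENNReal.rpow_one]

/-- boundedness of the Hardy–Littlewood maximal operator on the slice space. -/
theorem maximal_bounded_on_slice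
    (n : ℕ) (hn : 1 ≤ n) (t r : ℝ) (ht : 0 < t) (hr : 1 < r)
    (q : ℝ≥0∞) (hq : 1 < q) (hq' : q ≠ ∞) :
    ∃ C : ℝ≥0, 0 < C ∧ ∀ f : En n → ℂ, LocallyIntegrable f volume →
      sliceNorm n t r q (maximal n f) ≤ (C : ℝ≥0∞) * sliceNormC n t r q f := by
  have hp : 1 < q.toReal := by
    rw [← ENNReal.toReal_one]
    exact (ENNReal.toReal_lt_toReal (by simp) hq').2 hq
  have hp0 : 0 < q.toReal := by linarith
  obtain ⟨K, hK, h1⟩ := AA_MM n ht hr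
  obtain ⟨L, hL, h2⟩ := strong_type n hp
  have hC : K * L ^ (1 / q.toReal) + 1 ≠ ∞ := by
    have : L ^ (1 / q.toReal) ≠ ∞ := ENNReal.rpow_ne_top_of_nonneg (by positivity) hL
    finiteness
  refine ⟨(K * L ^ (1 / q.toReal) + 1).toNNReal, ENNReal.toNNReal_pos (by simp) hC, fun f hf => ?_⟩
  rw [ENNReal.coe_toNNReal hC]
  have hfm : AEMeasurable (fun y => (‖f y‖₊ : ℝ≥0∞)) volume :=
    hf.aestronglyMeasurable.enorm
  set g := hfm.mk _ with hgdef
  have hg : Measurable g := hfm.measurable_mk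
  have hfg : (fun y => (‖f y‖₊ : ℝ≥0∞)) =ᵐ[volume] g := hfm.ae_eq_mk
  have hmax : maximal n f = MM g := by
    ext x
    unfold maximal MM
    congr! 4 with ρ hρ
    exact lintegral_congr_ae (ae_restrict_of_ae hfg)
  have hsl : sliceNormC n t r q f = (∫⁻ x, AA t r g x ^ q.toReal) ^ (1 / q.toReal) := by
    unfold sliceNormC sliceNorm AA
    rw [if_neg hq']
    congr! 6 with x
    refine lintegral_congr_ae (ae_restrict_of_ae ?_)
    filter_upwards [hfg] with y hy
    rw [hy]
  have hsl2 : sliceNorm n t r q (maximal n f) =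
      (∫⁻ x, AA t r (MM g) x ^ q.toReal) ^ (1 / q.toReal) := by
    unfold sliceNorm AA
    rw [if_neg hq', hmax]
  rw [hsl, hsl2]
  calc (∫⁻ x, AA t r (MM g) x ^ q.toReal) ^ (1 / q.toReal)
      ≤ (∫⁻ x, K ^ q.toReal * MM (AA t r g) x ^ q.toReal) ^ (1 / q.toReal) := by
        gcongr with x
        rw [← ENNReal.mul_rpow_of_nonneg _ _ hp0.le]
        gcongr
        exact h1 g hg x
    _ ≤ (K ^ q.toReal * (L * ∫⁻ x, AA t r g x ^ q.toReal)) ^ (1 / q.toReal) := by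
        rw [lintegral_const_mul _ ((measurable_MM _).pow_const _)]
        gcongr
        exact h2 _ (measurable_AA t r hg)
    _ = K * L ^ (1 / q.toReal) * (∫⁻ x, AA t r g x ^ q.toReal) ^ (1 / q.toReal) := by
        rw [ENNReal.mul_rpow_of_nonneg _ _ (by positivity),
          ENNReal.mul_rpow_of_nonneg _ _ (by positivity), ← ENNReal.rpow_mul,
          mul_one_div_cancel hp0.ne', ENNReal.rpow_one, mul_assoc]
    _ ≤ _ := by
        gcongr
        exact le_self_add
end
end

section
/- Let n ≥ 1, t ∈ (0,∞) and r ∈ (1,∞). Then the Hardy–Littlewood maximal operator is bounded from the slice space (E_r^1)_t(ℝⁿ) to the weak slice space W(E_r^1)_t(ℝⁿ): there is a constant C > 0, independent of f, such that for every locally integrable f : ℝⁿ → ℂ, sup_{λ>0} λ ‖1_{{x ∈ ℝⁿ : Mf(x) > λ}}‖_{(E_r^1)_t} ≤ C ‖f‖_{(E_r^1)_t}. -/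
open MeasureTheory Metric Set ENNReal
open scoped NNReal

noncomputable section

lemma vol_ball_aux (n : ℕ) (x : En n) {ρ : ℝ} (hρ : 0 < ρ) :
    volume (ball x ρ) = ENNReal.ofReal (ρ ^ n) * volume (ball (0 : En n) 1) := by
  rw [Measure.addHaar_ball_of_pos volume x hρ, finrank_euclideanSpace_fin]

lemma vol_ball_double (n : ℕ) (x y : En n) {ρ : ℝ} (hρ : 0 < ρ) :
    volume (ball x (2 * ρ)) = 2 ^ n * volume (ball y ρ) := by
  rw [vol_ball_aux n x (by positivity), vol_ball_aux n y hρ, mul_pow,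
    ENNReal.ofReal_mul (by positivity), ENNReal.ofReal_pow (by norm_num), mul_assoc]
  simp

lemma vol_closedBall_five (n : ℕ) (x : En n) {ρ : ℝ} (hρ : 0 < ρ) :
    volume (closedBall x (5 * ρ)) = 5 ^ n * volume (ball x ρ) := by
  rw [Measure.addHaar_closedBall volume x (by positivity), finrank_euclideanSpace_fin,
    vol_ball_aux n x hρ, mul_pow,
    ENNReal.ofReal_mul (by positivity), ENNReal.ofReal_pow (by norm_num), mul_assoc]
  simp

/-- Weak type (1,1) for the maximal operator with bounded radii. -/
lemma weak11_bdd (n : ℕ) (g : En n → ℝ≥0∞) (lam : ℝ≥0∞) (R : ℝ) :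
    lam * volume {x : En n | ∃ ρ : ℝ, 0 < ρ ∧ ρ ≤ R ∧
      lam * volume (ball x ρ) < ∫⁻ y in ball x ρ, g y} ≤ 5 ^ n * ∫⁻ y, g y := by
  set S := {x : En n | ∃ ρ : ℝ, 0 < ρ ∧ ρ ≤ R ∧
      lam * volume (ball x ρ) < ∫⁻ y in ball x ρ, g y} with hS
  have hS' : ∀ x : En n, ∃ ρ : ℝ, x ∈ S → (0 < ρ ∧ ρ ≤ R ∧
      lam * volume (ball x ρ) < ∫⁻ y in ball x ρ, g y) := by
    intro x
    by_cases hx : x ∈ S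
    · obtain ⟨ρ, h⟩ := hx
      exact ⟨ρ, fun _ => h⟩
    · exact ⟨0, fun h => absurd h hx⟩
  choose ρ hρ using hS'
  obtain ⟨u, huS, hdis, hcov⟩ := Vitali.exists_disjoint_subfamily_covering_enlargement_closedBall
    S (fun x => x) ρ R (fun a ha => (hρ a ha).2.1) 5 (by norm_num)
  have hcount : u.Countable := hdis.countable_of_nonempty_interior fun a ha =>
    (nonempty_ball.2 (hρ a (huS ha)).1).mono ball_subset_interior_closedBall
  have hsub : S ⊆ ⋃ a ∈ u, closedBall a (5 * ρ a) := by
    intro x hx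
    obtain ⟨b, hb, h⟩ := hcov x hx
    exact mem_biUnion hb (h (mem_closedBall_self (hρ x hx).1.le))
  calc lam * volume S ≤ lam * ∑' a : u, volume (closedBall (a : En n) (5 * ρ a)) := by
        gcongr
        exact (measure_mono hsub).trans (measure_biUnion_le _ hcount _)
    _ = ∑' a : u, 5 ^ n * (lam * volume (ball (a : En n) (ρ a))) := by
        rw [← ENNReal.tsum_mul_left]
        congr 1 with a
        rw [vol_closedBall_five n _ (hρ a (huS a.2)).1]
        ring
    _ ≤ ∑' a : u, 5 ^ n * (∫⁻ y in ball (a : En n) (ρ a), g y) := by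
        gcongr with a
        exact (hρ a (huS a.2)).2.2.le
    _ = 5 ^ n * ∫⁻ y in ⋃ a ∈ u, ball a (ρ a), g y := by
        rw [ENNReal.tsum_mul_left, lintegral_biUnion hcount (fun _ _ => measurableSet_ball)
          (hdis.mono fun a => ball_subset_closedBall)]
    _ ≤ 5 ^ n * ∫⁻ y, g y := by
        gcongr
        exact Measure.restrict_le_self

lemma weak11 (n : ℕ) (g : En n → ℝ≥0∞) (lam : ℝ≥0∞) :
    lam * volume {x : En n | ∃ ρ : ℝ, 0 < ρ ∧
      lam * volume (ball x ρ) < ∫⁻ y in ball x ρ, g y} ≤ 5 ^ n * ∫⁻ y, g y := by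
  have h : {x : En n | ∃ ρ : ℝ, 0 < ρ ∧ lam * volume (ball x ρ) < ∫⁻ y in ball x ρ, g y} =
      ⋃ N : ℕ, {x : En n | ∃ ρ : ℝ, 0 < ρ ∧ ρ ≤ (N : ℝ) ∧
        lam * volume (ball x ρ) < ∫⁻ y in ball x ρ, g y} := by
    ext x
    simp only [mem_setOf_eq, mem_iUnion]
    constructor
    · rintro ⟨ρ, h0, h⟩
      obtain ⟨N, hN⟩ := exists_nat_ge ρ
      exact ⟨N, ρ, h0, hN, h⟩
    · rintro ⟨N, ρ, h0, hN, h⟩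
      exact ⟨ρ, h0, h⟩
  rw [h, Monotone.measure_iUnion, ENNReal.mul_iSup]
  · exact iSup_le fun N => weak11_bdd n g lam N
  · intro N M hNM x
    rintro ⟨ρ, h0, h1, h2⟩
    exact ⟨ρ, h0, h1.trans (by exact_mod_cast hNM), h2⟩

lemma ball_vol_ne (n : ℕ) (x : En n) {ρ : ℝ} (hρ : 0 < ρ) :
    volume (ball x ρ) ≠ 0 ∧ volume (ball x ρ) ≠ ∞ :=
  ⟨(measure_ball_pos volume x hρ).ne', measure_ball_lt_top.ne⟩

lemma jensen_ball (n : ℕ) (g : En n → ℝ≥0∞) (hg : Measurable g) {r : ℝ} (hr : 1 < r)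
    (x : En n) {ρ : ℝ} (hρ : 0 < ρ) :
    (volume (ball x ρ))⁻¹ * ∫⁻ y in ball x ρ, g y ≤
      ((volume (ball x ρ))⁻¹ * ∫⁻ y in ball x ρ, g y ^ r) ^ (1 / r) := by
  obtain ⟨h0, h1⟩ := ball_vol_ne n x hρ
  set μ : Measure (En n) := (volume (ball x ρ))⁻¹ • volume.restrict (ball x ρ) with hμ
  haveI : IsProbabilityMeasure μ := ⟨by
    simp [hμ, ENNReal.inv_mul_cancel h0 h1]⟩
  have := eLpNorm'_le_eLpNorm'_of_exponent_le (f := g) one_pos hr.le μ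
    hg.aestronglyMeasurable
  simpa [eLpNorm', hμ, lintegral_smul_measure] using this

lemma meas_ball_int (n : ℕ) (g : En n → ℝ≥0∞) (hg : Measurable g) (t : ℝ) :
    Measurable (Function.uncurry fun (x y : En n) => (ball x t).indicator g y) := by
  have : (Function.uncurry fun (x y : En n) => (ball x t).indicator g y) =
      {p : En n × En n | dist p.2 p.1 < t}.indicator (fun p => g p.2) := by
    ext ⟨x, y⟩
    simp [Function.uncurry, indicator, mem_ball]
  rw [this]
  exact (hg.comp measurable_snd).indicator
    (isOpen_lt (by fun_prop) (by fun_prop)).measurableSet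

lemma meas_ball_int' (n : ℕ) (g : En n → ℝ≥0∞) (hg : Measurable g) (t : ℝ) :
    Measurable (fun x : En n => ∫⁻ y in ball x t, g y) := by
  have := (meas_ball_int n g hg t).lintegral_prod_right' (ν := volume)
  simpa [Function.uncurry, lintegral_indicator measurableSet_ball] using this

lemma int_avg (n : ℕ) (g : En n → ℝ≥0∞) (hg : Measurable g) {t : ℝ} (ht : 0 < t) :
    ∫⁻ y, g y = ∫⁻ x : En n, (volume (ball x t))⁻¹ * ∫⁻ y in ball x t, g y := by
  obtain ⟨h0, h1⟩ := ball_vol_ne n 0 ht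
  have hv : ∀ x : En n, volume (ball x t) = volume (ball (0 : En n) t) := fun x => by
    rw [vol_ball_aux n x ht, vol_ball_aux n 0 ht]
  simp_rw [hv]
  rw [lintegral_const_mul _ (meas_ball_int' n g hg t)]
  simp_rw [← lintegral_indicator measurableSet_ball]
  rw [lintegral_lintegral_swap (meas_ball_int n g hg t).aemeasurable]
  have : ∀ y : En n, ∫⁻ x : En n, (ball x t).indicator g y = g y * volume (ball (0 : En n) t) := by
    intro y
    have h2 : (fun x : En n => (ball x t).indicator g y) = (ball y t).indicator fun _ => g y := by
      ext x
      simp [indicator, mem_ball, dist_comm]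
    rw [h2, lintegral_indicator measurableSet_ball, setLIntegral_const, hv]
  simp_rw [this]
  rw [lintegral_mul_const _ hg, mul_comm (∫⁻ y, g y), ← mul_assoc, ENNReal.inv_mul_cancel h0 h1,
    one_mul]

lemma rpow_sum_le_aux {ι : Type*} (s : Finset ι) (a : ι → ℝ≥0∞) {p : ℝ} (hp : 0 < p) (hp1 : p ≤ 1) :
    (∑ i ∈ s, a i) ^ p ≤ ∑ i ∈ s, a i ^ p := by
  classical
  induction s using Finset.induction_on with
  | empty => simp [hp]
  | insert i s hi ih =>
    rw [Finset.sum_insert hi, Finset.sum_insert hi]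
    exact (ENNReal.rpow_add_le_add_rpow _ _ hp.le hp1).trans (by gcongr)

/-- Enlarging the balls by a factor two. -/
lemma double_slice (n : ℕ) {t r : ℝ} (ht : 0 < t) (hr : 1 < r) :
    ∃ N : ℕ, ∀ G : En n → ℝ≥0∞, Measurable G →
      ∫⁻ x : En n, ((volume (ball x t))⁻¹ * ∫⁻ y in ball x (2 * t), G y) ^ (1 / r) ≤
      N * ∫⁻ x : En n, ((volume (ball x t))⁻¹ * ∫⁻ y in ball x t, G y) ^ (1 / r) := by
  classical
  obtain ⟨s, -, hfin, hs⟩ := (isCompact_closedBall (0 : En n) (2 * t)).finite_cover_balls ht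
  lift s to Finset (En n) using hfin
  have hv : ∀ x : En n, volume (ball x t) = volume (ball (0 : En n) t) := fun x => by
    rw [vol_ball_aux n x ht, vol_ball_aux n 0 ht]
  have hr0 : 0 < 1 / r := by positivity
  have hr1 : 1 / r ≤ 1 := by rw [div_le_one (by linarith)]; exact hr.le
  refine ⟨s.card, fun G hG => ?_⟩
  set F : En n → ℝ≥0∞ := fun x => ((volume (ball x t))⁻¹ * ∫⁻ y in ball x t, G y) ^ (1 / r) with hF
  have hFm : Measurable F := by
    rw [hF]
    simp_rw [hv]
    exact ((meas_ball_int' n G hG t).const_mul _).pow_const _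
  calc _ ≤ ∫⁻ x : En n, ∑ z ∈ s, F (x + z) := by
        apply lintegral_mono
        intro x
        simp only [hF]
        refine le_trans ?_ (rpow_sum_le_aux s _ hr0 hr1)
        gcongr
        simp_rw [hv]
        rw [← Finset.mul_sum]
        gcongr
        have hsub : ball x (2 * t) ⊆ ⋃ z ∈ s, ball (x + z) t := by
          intro y hy
          have : y - x ∈ closedBall (0 : En n) (2 * t) := by
            rw [mem_ball, dist_eq_norm] at hy
            simpa using hy.le
          obtain ⟨z, hz, h⟩ := mem_iUnion₂.1 (hs this)
          refine mem_iUnion₂.2 ⟨z, hz, ?_⟩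
          rw [mem_ball, dist_eq_norm] at h ⊢
          rwa [← sub_sub]
        refine (lintegral_mono_set hsub).trans ?_
        have := lintegral_iUnion_le (μ := volume) (fun z : s => ball (x + z.1) t) G
        rw [tsum_fintype, Finset.sum_coe_sort s (fun z => ∫⁻ y in ball (x + z) t, G y)] at this
        rw [iUnion_subtype (fun z => z ∈ s) (fun z => ball (x + z.1) t)] at this
        exact this
    _ = ∑ z ∈ s, ∫⁻ x, F (x + z) := lintegral_finset_sum _ fun z _ => hFm.comp (by fun_prop)
    _ = s.card * ∫⁻ x, F x := by
        simp_rw [lintegral_add_right_eq_self]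
        simp

/-- Main estimate for measurable `ℝ≥0∞`-valued functions. -/
lemma main_est (n : ℕ) {t r : ℝ} (ht : 0 < t) (hr : 1 < r) :
    ∃ C : ℝ≥0, 0 < C ∧ ∀ g : En n → ℝ≥0∞, Measurable g → ∀ lam : ℝ≥0, 0 < lam →
      ∀ E : Set (En n), E = {x : En n | ∃ ρ : ℝ, 0 < ρ ∧
        (lam : ℝ≥0∞) * volume (ball x ρ) < ∫⁻ y in ball x ρ, g y} →
      (lam : ℝ≥0∞) * ∫⁻ x : En n, ((volume (ball x t))⁻¹ * volume (E ∩ ball x t)) ^ (1 / r) ≤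
      C * ∫⁻ x : En n, ((volume (ball x t))⁻¹ * ∫⁻ y in ball x t, g y ^ r) ^ (1 / r) := by
  obtain ⟨N, hN⟩ := double_slice n ht hr
  have hr0 : 0 < 1 / r := by positivity
  have hr1 : 1 / r ≤ 1 := by rw [div_le_one (by linarith)]; exact hr.le
  refine ⟨5 ^ n * N + 2 ^ n * 5 ^ n, by positivity, ?_⟩
  intro g hg lam hlam E hE
  have hl0 : (lam : ℝ≥0∞) ≠ 0 := by exact_mod_cast hlam.ne'
  have hlt : (lam : ℝ≥0∞) ≠ ∞ := coe_ne_top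
  have h20 : (2 ^ n : ℝ≥0∞) ≠ 0 := by positivity
  have h2t : (2 ^ n : ℝ≥0∞) ≠ ∞ := by simp
  set S := {x : En n | ∃ ρ : ℝ, 0 < ρ ∧
        ((lam : ℝ≥0∞) / 2 ^ n) * volume (ball x ρ) < ∫⁻ y in ball x ρ, g y} with hS
  have hSw : (lam : ℝ≥0∞) * volume S ≤ 2 ^ n * 5 ^ n * ∫⁻ y, g y := by
    have h := weak11 n g ((lam : ℝ≥0∞) / 2 ^ n)
    calc (lam : ℝ≥0∞) * volume S = 2 ^ n * ((lam : ℝ≥0∞) / 2 ^ n * volume S) := by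
          rw [← mul_assoc, ENNReal.mul_div_cancel h20 h2t]
      _ ≤ 2 ^ n * (5 ^ n * ∫⁻ y, g y) := by gcongr
      _ = _ := by ring
  set G : En n → ℝ≥0∞ := fun y => g y ^ r with hG
  have hGm : Measurable G := hg.pow_const _
  -- pointwise estimate
  have hpt : ∀ x : En n,
      (lam : ℝ≥0∞) * ((volume (ball x t))⁻¹ * volume (E ∩ ball x t)) ^ (1 / r) ≤
      5 ^ n * ((volume (ball x t))⁻¹ * ∫⁻ y in ball x (2 * t), G y) ^ (1 / r) +
        (toMeasurable volume S).indicator (fun _ => (lam : ℝ≥0∞)) x := by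
    intro x
    obtain ⟨hb0, hbt⟩ := ball_vol_ne n x ht
    by_cases hx : x ∈ S
    · rw [indicator_of_mem (subset_toMeasurable _ _ hx)]
      refine le_trans ?_ le_add_self
      have : ((volume (ball x t))⁻¹ * volume (E ∩ ball x t)) ^ (1 / r) ≤ 1 := by
        apply ENNReal.rpow_le_one _ hr0.le
        calc _ ≤ (volume (ball x t))⁻¹ * volume (ball x t) := by
              gcongr
              exact inter_subset_right
          _ = 1 := ENNReal.inv_mul_cancel hb0 hbt
      calc _ ≤ (lam : ℝ≥0∞) * 1 := by gcongr
        _ = lam := mul_one _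
    · refine le_trans ?_ le_self_add
      have hsub : E ∩ ball x t ⊆ {y : En n | ∃ ρ : ℝ, 0 < ρ ∧
          (lam : ℝ≥0∞) ^ r * volume (ball y ρ) <
            ∫⁻ z in ball y ρ, (ball x (2 * t)).indicator G z} := by
        rintro y ⟨hyE, hyx⟩
        rw [hE] at hyE
        obtain ⟨ρ, h0, hρ⟩ := hyE
        obtain ⟨hc0, hct⟩ := ball_vol_ne n y h0
        have hρt : ρ ≤ t := by
          by_contra! hcon
          apply hx
          refine ⟨2 * ρ, by positivity, ?_⟩
          rw [vol_ball_double n x y h0, ← mul_assoc, ENNReal.div_mul_cancel h20 h2t]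
          refine hρ.trans_le (lintegral_mono_set (ball_subset_ball' ?_))
          rw [mem_ball] at hyx
          linarith
        refine ⟨ρ, h0, ?_⟩
        have hss : ball y ρ ⊆ ball x (2 * t) := ball_subset_ball' (by
          rw [mem_ball] at hyx
          linarith)
        have heq : ∫⁻ z in ball y ρ, (ball x (2 * t)).indicator G z = ∫⁻ z in ball y ρ, G z :=
          setLIntegral_congr_fun measurableSet_ball fun z hz => indicator_of_mem (hss hz) _
        rw [heq]
        have hj := jensen_ball n g hg hr y h0
        have h1 : (lam : ℝ≥0∞) < (volume (ball y ρ))⁻¹ * ∫⁻ z in ball y ρ, g z := by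
          rw [mul_comm, ← div_eq_mul_inv]
          exact (ENNReal.lt_div_iff_mul_lt (Or.inl hc0) (Or.inl hct)).2 hρ
        have h2 := ENNReal.rpow_lt_rpow (h1.trans_le hj) (by linarith : 0 < r)
        rw [← ENNReal.rpow_mul, one_div_mul_cancel (by linarith), ENNReal.rpow_one, mul_comm,
          ← div_eq_mul_inv] at h2
        exact (ENNReal.lt_div_iff_mul_lt (Or.inl hc0) (Or.inl hct)).1 h2
      have hw := weak11 n ((ball x (2 * t)).indicator G) ((lam : ℝ≥0∞) ^ r)
      rw [lintegral_indicator measurableSet_ball] at hw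
      have hw2 : (lam : ℝ≥0∞) ^ r * volume (E ∩ ball x t) ≤
          5 ^ n * ∫⁻ y in ball x (2 * t), G y := le_trans (by gcongr) hw
      calc (lam : ℝ≥0∞) * ((volume (ball x t))⁻¹ * volume (E ∩ ball x t)) ^ (1 / r)
          = ((lam : ℝ≥0∞) ^ r) ^ (1 / r) *
            ((volume (ball x t))⁻¹ * volume (E ∩ ball x t)) ^ (1 / r) := by
            rw [← ENNReal.rpow_mul, mul_one_div_cancel (by linarith), ENNReal.rpow_one]
        _ = ((volume (ball x t))⁻¹ * ((lam : ℝ≥0∞) ^ r * volume (E ∩ ball x t))) ^ (1 / r) := by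
            rw [← ENNReal.mul_rpow_of_nonneg _ _ hr0.le]
            congr 1
            ring
        _ ≤ ((volume (ball x t))⁻¹ * (5 ^ n * ∫⁻ y in ball x (2 * t), G y)) ^ (1 / r) := by
            gcongr
        _ = (5 ^ n) ^ (1 / r) *
            ((volume (ball x t))⁻¹ * ∫⁻ y in ball x (2 * t), G y) ^ (1 / r) := by
            rw [← ENNReal.mul_rpow_of_nonneg _ _ hr0.le]
            congr 1
            ring
        _ ≤ _ := by
            gcongr
            have h5 : (1 : ℝ≥0∞) ≤ 5 ^ n := one_le_pow₀ (by norm_num)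
            simpa using ENNReal.rpow_le_rpow_of_exponent_le h5 hr1
  set A := ∫⁻ x : En n, ((volume (ball x t))⁻¹ * ∫⁻ y in ball x t, G y) ^ (1 / r) with hA
  have hgA : ∫⁻ y, g y ≤ A := by
    rw [int_avg n g hg ht]
    exact lintegral_mono fun x => jensen_ball n g hg hr x ht
  rw [← lintegral_const_mul' _ _ hlt]
  calc _ ≤ ∫⁻ x : En n, (5 ^ n * ((volume (ball x t))⁻¹ * ∫⁻ y in ball x (2 * t), G y) ^ (1 / r) +
        (toMeasurable volume S).indicator (fun _ => (lam : ℝ≥0∞)) x) := lintegral_mono hpt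
    _ = 5 ^ n * (∫⁻ x : En n, ((volume (ball x t))⁻¹ * ∫⁻ y in ball x (2 * t), G y) ^ (1 / r)) +
        lam * volume S := by
        rw [lintegral_add_right _ (measurable_const.indicator (measurableSet_toMeasurable _ _)),
          lintegral_const_mul' _ _ (by simp),
          lintegral_indicator (measurableSet_toMeasurable _ _), setLIntegral_const,
          measure_toMeasurable]
    _ ≤ 5 ^ n * (N * A) + 2 ^ n * 5 ^ n * A := by
        refine add_le_add ?_ (hSw.trans (by gcongr))
        gcongr
        exact hN G hGm
    _ = _ := by
        push_cast
        ring

/-- weak-type boundedness of the Hardy–Littlewood maximal operator from the slice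
space `(E_r^1)_t` to the weak slice space `W(E_r^1)_t`. -/
theorem maximal_weak_bounded_on_slice
    (n : ℕ) (hn : 1 ≤ n) (t r : ℝ) (ht : 0 < t) (hr : 1 < r) :
    ∃ C : ℝ≥0, 0 < C ∧ ∀ f : En n → ℂ, LocallyIntegrable f volume →
      ∀ lam : ℝ≥0, 0 < lam →
        (lam : ℝ≥0∞) *
          sliceNorm n t r 1
            (({x | (lam : ℝ≥0∞) < maximal n f x}).indicator fun _ => (1 : ℝ≥0∞))
        ≤ (C : ℝ≥0∞) * sliceNormC n t r 1 f := by
  obtain ⟨C, hC, h⟩ := main_est n ht hr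
  refine ⟨C, hC, fun f hf lam hlam => ?_⟩
  have hae : AEMeasurable (fun y => (‖f y‖₊ : ℝ≥0∞)) volume :=
    hf.aestronglyMeasurable.enorm
  obtain ⟨g, hg, hfg⟩ := hae
  have hE : {x | (lam : ℝ≥0∞) < maximal n f x} = {x : En n | ∃ ρ : ℝ, 0 < ρ ∧
        (lam : ℝ≥0∞) * volume (ball x ρ) < ∫⁻ y in ball x ρ, g y} := by
    ext x
    simp only [mem_setOf_eq, maximal, lt_iSup_iff]
    constructor
    · rintro ⟨ρ, h0, h1⟩
      obtain ⟨hc0, hct⟩ := ball_vol_ne n x h0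
      refine ⟨ρ, h0, ?_⟩
      rw [lintegral_congr_ae (ae_restrict_of_ae hfg), mul_comm, ← div_eq_mul_inv] at h1
      exact (ENNReal.lt_div_iff_mul_lt (Or.inl hc0) (Or.inl hct)).1 h1
    · rintro ⟨ρ, h0, h1⟩
      obtain ⟨hc0, hct⟩ := ball_vol_ne n x h0
      refine ⟨ρ, h0, ?_⟩
      rw [lintegral_congr_ae (ae_restrict_of_ae hfg), mul_comm, ← div_eq_mul_inv]
      exact (ENNReal.lt_div_iff_mul_lt (Or.inl hc0) (Or.inl hct)).2 h1
  have hm := h g hg lam hlam _ hE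
  have hR : sliceNormC n t r 1 f =
      ∫⁻ x : En n, ((volume (ball x t))⁻¹ * ∫⁻ y in ball x t, g y ^ r) ^ (1 / r) := by
    unfold sliceNormC sliceNorm
    rw [if_neg one_ne_top]
    simp only [ENNReal.toReal_one, ENNReal.rpow_one, div_one]
    congr 1 with x
    congr 2
    apply lintegral_congr_ae
    apply ae_restrict_of_ae
    filter_upwards [hfg] with y hy
    rw [hy]
  rw [hR]
  refine le_trans ?_ hm
  gcongr
  unfold sliceNorm
  rw [if_neg one_ne_top]
  simp only [ENNReal.toReal_one, ENNReal.rpow_one, div_one]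
  refine lintegral_mono fun x => ?_
  gcongr
  set E := {x | (lam : ℝ≥0∞) < maximal n f x}
  have : ∀ y, (E.indicator (fun _ => (1 : ℝ≥0∞)) y) ^ r = E.indicator 1 y := by
    intro y
    by_cases hy : y ∈ E
    · simp [hy]
    · simp [hy, (by linarith : 0 < r)]
  simp_rw [this]
  refine (lintegral_indicator_one_le _).trans ?_
  rw [Measure.restrict_apply' measurableSet_ball]
end
end
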